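/- arXiv:0711.1766 — 5 statements merged into one kernel-verified Lean document; each statement's English description precedes it below -/
import Mathlib

section
/- Let S be a nonnegative, measurable, integrable power spectrum on I with ∫ S(f) df > 0. The function θ ↦ ∫ min(S(f), θ) df is nondecreasing and continuous on [0, ∞), equals 0 at θ = 0, and converges to ∫ S(f) df as θ → ∞. Consequently, for every distortion level D with 0 < D < ∫ S(f) df there exists a water level θ > 0 such that ∫ min(S(f), θ) df = D (existence of the water-filling parameter defining the quadratic-Gaussian rate-distortion function). -/
open MeasureTheory Real Filter

/-- Lebesgue measure restricted to the frequency interval `I = [-1/2, 1/2]`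
(a probability measure). -/
noncomputable def freqMeasure : Measure ℝ :=
  volume.restrict (Set.Icc (-(1/2) : ℝ) (1/2))

section Truncation

variable {α : Type*} [MeasurableSpace α] {μ : Measure α} {g : α → ℝ}

theorem ae_norm_min_const_le (hg : ∀ᵐ x ∂μ, 0 ≤ g x) {θ : ℝ} (hθ : 0 ≤ θ) :
    ∀ᵐ x ∂μ, ‖min (g x) θ‖ ≤ g x := by
  filter_upwards [hg] with x hx
  rw [Real.norm_of_nonneg (le_min hx hθ)]
  exact min_le_left _ _

theorem aestronglyMeasurable_min_const (hg : AEStronglyMeasurable g μ) (θ : ℝ) :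
    AEStronglyMeasurable (fun x => min (g x) θ) μ :=
  hg.inf aestronglyMeasurable_const

theorem integrable_min_const (hg : ∀ᵐ x ∂μ, 0 ≤ g x) (hgi : Integrable g μ) {θ : ℝ}
    (hθ : 0 ≤ θ) : Integrable (fun x => min (g x) θ) μ :=
  hgi.mono' (aestronglyMeasurable_min_const hgi.1 θ) (ae_norm_min_const_le hg hθ)

theorem monotoneOn_integral_min_const (hg : ∀ᵐ x ∂μ, 0 ≤ g x) (hgi : Integrable g μ) :
    MonotoneOn (fun θ : ℝ => ∫ x, min (g x) θ ∂μ) (Set.Ici 0) := fun _ ha _ hb hab =>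
  integral_mono (integrable_min_const hg hgi ha) (integrable_min_const hg hgi hb)
    fun _ => min_le_min_left _ hab

theorem continuousOn_integral_min_const (hg : ∀ᵐ x ∂μ, 0 ≤ g x) (hgi : Integrable g μ) :
    ContinuousOn (fun θ : ℝ => ∫ x, min (g x) θ ∂μ) (Set.Ici 0) :=
  continuousOn_of_dominated (fun θ _ => aestronglyMeasurable_min_const hgi.1 θ)
    (fun _ hθ => ae_norm_min_const_le hg hθ) hgi
    (Eventually.of_forall fun _ => by fun_prop)

theorem integral_min_zero (hg : ∀ᵐ x ∂μ, 0 ≤ g x) : ∫ x, min (g x) 0 ∂μ = 0 :=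
  integral_eq_zero_of_ae (hg.mono fun _ hx => min_eq_right hx)

theorem tendsto_integral_min_const_atTop (hg : ∀ᵐ x ∂μ, 0 ≤ g x) (hgi : Integrable g μ) :
    Tendsto (fun θ : ℝ => ∫ x, min (g x) θ ∂μ) atTop (nhds (∫ x, g x ∂μ)) := by
  refine tendsto_integral_filter_of_dominated_convergence g
    (Eventually.of_forall (aestronglyMeasurable_min_const hgi.1))
    ((eventually_ge_atTop 0).mono fun _ hθ => ae_norm_min_const_le hg hθ) hgi
    (Eventually.of_forall fun x => tendsto_const_nhds.congr' ?_)
  filter_upwards [eventually_ge_atTop (g x)] with θ hθ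
  exact (min_eq_left hθ).symm

theorem exists_pos_integral_min_const_eq (hg : ∀ᵐ x ∂μ, 0 ≤ g x) (hgi : Integrable g μ)
    {D : ℝ} (hD : 0 < D) (hDlt : D < ∫ x, g x ∂μ) :
    ∃ θ > (0 : ℝ), ∫ x, min (g x) θ ∂μ = D := by
  obtain ⟨M, hM, hM0⟩ := (((tendsto_integral_min_const_atTop hg hgi).eventually_const_lt
    hDlt).and (eventually_ge_atTop 0)).exists
  obtain ⟨θ, hθ, h⟩ := intermediate_value_Ioo hM0
    ((continuousOn_integral_min_const hg hgi).mono Set.Icc_subset_Ici_self)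
    ⟨(integral_min_zero hg).trans_lt hD, hM⟩
  exact ⟨θ, hθ.1, h⟩

end Truncation

/-- Existence of the water-filling parameter defining the quadratic-Gaussian
rate-distortion function: the total distortion `θ ↦ ∫ min(S f, θ) df` is
nondecreasing and continuous on `[0, ∞)`, vanishes at `θ = 0`, tends to
`∫ S` at infinity, and hence attains every distortion level `0 < D < ∫ S`. -/
theorem waterfilling_parameter_exists
    (S : ℝ → ℝ) (hSmeas : Measurable S)
    (hSnonneg : ∀ᵐ f ∂freqMeasure, 0 ≤ S f)
    (hSint : Integrable S freqMeasure)
    (hSpos : 0 < ∫ f, S f ∂freqMeasure) :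
    MonotoneOn (fun θ : ℝ => ∫ f, min (S f) θ ∂freqMeasure) (Set.Ici 0) ∧
    ContinuousOn (fun θ : ℝ => ∫ f, min (S f) θ ∂freqMeasure) (Set.Ici 0) ∧
    (∫ f, min (S f) (0 : ℝ) ∂freqMeasure) = 0 ∧
    Tendsto (fun θ : ℝ => ∫ f, min (S f) θ ∂freqMeasure) atTop
      (nhds (∫ f, S f ∂freqMeasure)) ∧
    ∀ D : ℝ, 0 < D → D < ∫ f, S f ∂freqMeasure →
      ∃ θ > (0 : ℝ), (∫ f, min (S f) θ ∂freqMeasure) = D :=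
  ⟨monotoneOn_integral_min_const hSnonneg hSint,
    continuousOn_integral_min_const hSnonneg hSint,
    integral_min_zero hSnonneg,
    tendsto_integral_min_const_atTop hSnonneg hSint,
    fun _ => exists_pos_integral_min_const_eq hSnonneg hSint⟩
end

section
/- (Spectral form of the main theorem: the scalar mutual information of the predictive test channel equals R(D).) Let S be a measurable power spectrum on I with S(f) > 0 a.e. and log S integrable on I, and let θ > 0. Then ∫ (1/2) log( S(f)/min(S(f), θ) ) df = (1/2) log( P_e(max(θ, S)) / θ ). Equivalently, setting σ∞² := P_e(max(θ, S)) − θ, which is nonnegative, the water-filling rate-distortion integral equals (1/2) log(1 + σ∞²/θ). -/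
open MeasureTheory Real Filter

instance : IsProbabilityMeasure freqMeasure :=
  ⟨by rw [freqMeasure, Measure.restrict_apply_univ, Real.volume_Icc]; norm_num⟩

/-- Almost everywhere, `log (max θ S)` is the maximum of the logarithms. -/
lemma log_max_ae_eq {α : Type*} [MeasurableSpace α] {μ : Measure α} {S : α → ℝ} {θ : ℝ}
    (hθ : 0 < θ) (hS : ∀ᵐ x ∂μ, 0 < S x) :
    (fun x => max (Real.log θ) (Real.log (S x))) =ᵐ[μ] fun x => Real.log (max θ (S x)) := by
  filter_upwards [hS] with x hx
  rcases le_total θ (S x) with h | h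
  · rw [max_eq_right h, max_eq_right (Real.log_le_log hθ h)]
  · rw [max_eq_left h, max_eq_left (Real.log_le_log hx h)]

lemma log_div_min_eq {s θ : ℝ} (hs : 0 < s) (hθ : 0 < θ) :
    Real.log (s / min s θ) = Real.log (max θ s) - Real.log θ := by
  rcases le_total θ s with h | h
  · rw [max_eq_right h, min_eq_right h, Real.log_div hs.ne' hθ.ne']
  · rw [max_eq_left h, min_eq_left h, div_self hs.ne', Real.log_one, sub_self]

/-- Spectral form of the main theorem: the water-filling rate-distortion
integral equals `(1/2) log(P_e(max(θ,S))/θ)`, where `max(θ,S)` is the spectrum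
of the reconstruction process `V`; equivalently, with the noisy prediction
error variance `σ∞² = P_e(max(θ,S)) − θ ≥ 0`, it equals
`(1/2) log(1 + σ∞²/θ)`, the scalar mutual information of the predictive
test channel. -/
theorem predictive_test_channel_spectral
    (S : ℝ → ℝ) (hSmeas : Measurable S)
    (hSpos : ∀ᵐ f ∂freqMeasure, 0 < S f)
    (hlogS : Integrable (fun f => Real.log (S f)) freqMeasure)
    (θ : ℝ) (hθ : 0 < θ) :
    (∫ f, (1/2) * Real.log (S f / min (S f) θ) ∂freqMeasure
      = (1/2) * Real.log
          (Real.exp (∫ f, Real.log (max θ (S f)) ∂freqMeasure) / θ)) ∧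
    0 ≤ Real.exp (∫ f, Real.log (max θ (S f)) ∂freqMeasure) - θ ∧
    ∫ f, (1/2) * Real.log (S f / min (S f) θ) ∂freqMeasure
      = (1/2) * Real.log (1 +
          (Real.exp (∫ f, Real.log (max θ (S f)) ∂freqMeasure) - θ) / θ) := by
  have h_int : Integrable (fun f => Real.log (max θ (S f))) freqMeasure :=
    ((integrable_const (Real.log θ)).sup hlogS).congr (log_max_ae_eq hθ hSpos)
  have hrate : ∫ f, (1/2) * Real.log (S f / min (S f) θ) ∂freqMeasure
      = (1/2) * Real.log
          (Real.exp (∫ f, Real.log (max θ (S f)) ∂freqMeasure) / θ) := by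
    have hae : (fun f => Real.log (S f / min (S f) θ)) =ᵐ[freqMeasure]
        fun f => Real.log (max θ (S f)) - Real.log θ := by
      filter_upwards [hSpos] with f hf using log_div_min_eq hf hθ
    rw [integral_const_mul, integral_congr_ae hae, integral_sub h_int (integrable_const _),
      Real.log_div (Real.exp_ne_zero _) hθ.ne', Real.log_exp]
    simp
  refine ⟨hrate, ?_, ?_⟩
  · have hle : Real.log θ ≤ ∫ f, Real.log (max θ (S f)) ∂freqMeasure := by
      calc Real.log θ = ∫ _, Real.log θ ∂freqMeasure := by simp
        _ ≤ _ := integral_mono (integrable_const _) h_int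
          fun f => Real.log_le_log hθ (le_max_left _ _)
    exact sub_nonneg.2 ((Real.log_le_iff_le_exp hθ).1 hle)
  · rw [hrate, sub_div, div_self hθ.ne', add_sub_cancel]
end

section
/- Let σ² > 0 and θ > 0, and let μ be the pushforward of the product measure (gaussianReal 0 σ²) ⊗ (gaussianReal 0 θ) on ℝ² under the map (x, n) ↦ (x, x + n), i.e., the joint law of input and output of an AWGN channel with Gaussian input of variance σ² and independent Gaussian noise of variance θ. Then the two marginals of μ are gaussianReal 0 σ² and gaussianReal 0 (σ² + θ), and the scalar mutual information klDiv( μ , (gaussianReal 0 σ²) ⊗ (gaussianReal 0 (σ² + θ)) ) equals (1/2) log(1 + σ²/θ) nats. -/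
open MeasureTheory ProbabilityTheory Real

/-- Kullback–Leibler divergence `∫ log(dμ/dν) dμ` in nats. -/
noncomputable def klDiv {α : Type*} [MeasurableSpace α] (μ ν : Measure α) : ℝ :=
  ∫ x, Real.log (μ.rnDeriv ν x).toReal ∂μ

/-- The density of the joint law of input and output of an AWGN channel with noise variance `θ`
with respect to the product of the input law and the centered Gaussian of variance `v`. -/
noncomputable def awgnDensity (θ v : NNReal) (p : ℝ × ℝ) : ENNReal :=
  ENNReal.ofReal (gaussianPDFReal 0 θ (p.2 - p.1) / gaussianPDFReal 0 v p.2)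

lemma measurable_awgnDensity (θ v : NNReal) : Measurable (awgnDensity θ v) := by
  unfold awgnDensity
  exact ENNReal.measurable_ofReal.comp
    (((measurable_gaussianPDFReal 0 θ).comp (measurable_snd.sub measurable_fst)).div
      ((measurable_gaussianPDFReal 0 v).comp measurable_snd))

lemma lintegral_gaussianReal {v : NNReal} (hv : v ≠ 0) (m : ℝ) {g : ℝ → ENNReal}
    (hg : Measurable g) :
    ∫⁻ x, g x ∂(gaussianReal m v) = ∫⁻ x, gaussianPDF m v x * g x := by
  rw [gaussianReal_of_var_ne_zero m hv,
    lintegral_withDensity_eq_lintegral_mul _ (measurable_gaussianPDF m v) hg]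
  rfl

lemma map_add_prod_gaussianReal_eq_withDensity (ρ : Measure ℝ) [SFinite ρ] {θ v : NNReal}
    (hθ : θ ≠ 0) (hv : v ≠ 0) :
    Measure.map (fun p : ℝ × ℝ => (p.1, p.1 + p.2)) (ρ.prod (gaussianReal 0 θ))
      = (ρ.prod (gaussianReal 0 v)).withDensity (awgnDensity θ v) := by
  have hm : Measurable (fun p : ℝ × ℝ => (p.1, p.1 + p.2)) := by fun_prop
  have hd := measurable_awgnDensity θ v
  refine Measure.ext_of_lintegral _ fun g hg => ?_
  rw [lintegral_map hg hm, lintegral_withDensity_eq_lintegral_mul _ hd hg,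
    lintegral_prod (fun p : ℝ × ℝ => g (p.1, p.1 + p.2)) (hg.comp hm).aemeasurable,
    lintegral_prod _ (hd.mul hg).aemeasurable]
  refine lintegral_congr fun x => ?_
  have hx : Measurable fun y : ℝ => (x, y) := measurable_prodMk_left
  change ∫⁻ n, g (x, x + n) ∂(gaussianReal 0 θ)
    = ∫⁻ y, awgnDensity θ v (x, y) * g (x, y) ∂(gaussianReal 0 v)
  rw [lintegral_gaussianReal hθ 0 (g := fun n => g (x, x + n)) ((hg.comp hm).comp hx),
    lintegral_gaussianReal hv 0 (g := fun y => awgnDensity θ v (x, y) * g (x, y))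
      ((hd.mul hg).comp hx),
    ← lintegral_add_left_eq_self (fun y => gaussianPDF 0 v y * (awgnDensity θ v (x, y) * g (x, y)))
      x]
  refine lintegral_congr fun n => ?_
  have h := gaussianPDFReal_pos 0 v (x + n) hv
  simp only [awgnDensity, gaussianPDF, add_sub_cancel_left]
  rw [← mul_assoc, ← ENNReal.ofReal_mul h.le, mul_div_cancel₀ _ h.ne']

lemma integrable_sq_gaussianReal (v : NNReal) :
    Integrable (fun x : ℝ => x ^ 2) (gaussianReal 0 v) :=
  (memLp_id_gaussianReal 2).integrable_sq

lemma integral_sq_gaussianReal (v : NNReal) : ∫ x, x ^ 2 ∂(gaussianReal 0 v) = v := by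
  have h := variance_fun_id_gaussianReal (μ := 0) (v := v)
  rw [variance_of_integral_eq_zero (by fun_prop) (by simp)] at h
  exact h

lemma log_gaussianPDFReal_zero {v : NNReal} (hv : 0 < v) (x : ℝ) :
    log (gaussianPDFReal 0 v x) = -(1 / 2) * log (2 * π) - 1 / 2 * log v - x ^ 2 / (2 * v) := by
  have hv' : (0 : ℝ) < v := hv
  rw [gaussianPDFReal, log_mul (by positivity) (exp_pos _).ne', log_exp, log_inv,
    log_sqrt (by positivity), log_mul (by positivity) hv'.ne']
  ring

/-- The scalar mutual information of an AWGN channel with Gaussian input of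
variance `σ²` and independent Gaussian noise of variance `θ`: the joint law
`μ` of `(X, X + N)` has marginals `N(0,σ²)` and `N(0,σ²+θ)`, and the KL
divergence of `μ` from the product of its marginals equals
`(1/2) log(1 + σ²/θ)` nats. -/
theorem awgn_scalar_mutual_information
    (σ2 θ : NNReal) (hσ : 0 < σ2) (hθ : 0 < θ)
    (μ : Measure (ℝ × ℝ))
    (hμ : μ = Measure.map (fun p : ℝ × ℝ => (p.1, p.1 + p.2))
      ((gaussianReal 0 σ2).prod (gaussianReal 0 θ))) :
    μ.map Prod.fst = gaussianReal 0 σ2 ∧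
    μ.map Prod.snd = gaussianReal 0 (σ2 + θ) ∧
    klDiv μ ((gaussianReal 0 σ2).prod (gaussianReal 0 (σ2 + θ)))
      = (1/2) * Real.log (1 + (σ2 : ℝ) / (θ : ℝ)) := by
  have hm : Measurable (fun p : ℝ × ℝ => (p.1, p.1 + p.2)) := by fun_prop
  have hfst : μ.map Prod.fst = gaussianReal 0 σ2 := by
    rw [hμ, Measure.map_map measurable_fst hm]
    exact Measure.fst_prod
  have hsnd : μ.map Prod.snd = gaussianReal 0 (σ2 + θ) := by
    rw [hμ, Measure.map_map measurable_snd hm]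
    simpa [Measure.conv, Function.comp_def] using
      gaussianReal_conv_gaussianReal (m₁ := 0) (m₂ := 0) (v₁ := σ2) (v₂ := θ)
  refine ⟨hfst, hsnd, ?_⟩
  have hv : 0 < σ2 + θ := add_pos hσ hθ
  have hθ' : (0 : ℝ) < θ := hθ
  have hv' : (0 : ℝ) < ((σ2 + θ : NNReal) : ℝ) := hv
  have hdens := hμ.trans
    (map_add_prod_gaussianReal_eq_withDensity (gaussianReal 0 σ2) hθ.ne' hv.ne')
  have hac : μ ≪ (gaussianReal 0 σ2).prod (gaussianReal 0 (σ2 + θ)) :=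
    hdens ▸ withDensity_absolutelyContinuous _ _
  have hrn : ∀ᵐ p ∂μ, μ.rnDeriv ((gaussianReal 0 σ2).prod (gaussianReal 0 (σ2 + θ))) p
      = awgnDensity θ (σ2 + θ) p := by
    have h := Measure.rnDeriv_withDensity ((gaussianReal 0 σ2).prod (gaussianReal 0 (σ2 + θ)))
      (measurable_awgnDensity θ (σ2 + θ))
    rw [← hdens] at h
    exact hac.ae_le h
  have hlog : ∀ p : ℝ × ℝ, log (awgnDensity θ (σ2 + θ) p).toReal
      = 1 / 2 * log (1 + (σ2 : ℝ) / θ) - (p.2 - p.1) ^ 2 / (2 * θ)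
        + p.2 ^ 2 / (2 * (σ2 + θ : NNReal)) := by
    intro p
    have h1 := gaussianPDFReal_pos 0 θ (p.2 - p.1) hθ.ne'
    have h2 := gaussianPDFReal_pos 0 (σ2 + θ) p.2 hv.ne'
    have h3 : 1 + (σ2 : ℝ) / θ = (σ2 + θ : NNReal) / θ := by
      push_cast
      field_simp
      ring
    rw [awgnDensity, ENNReal.toReal_ofReal (div_pos h1 h2).le, log_div h1.ne' h2.ne',
      log_gaussianPDFReal_zero hθ, log_gaussianPDFReal_zero hv, h3, log_div hv'.ne' hθ'.ne']
    ring
  have hprob : IsProbabilityMeasure μ :=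
    hμ ▸ Measure.isProbabilityMeasure_map hm.aemeasurable
  have hdiff : μ.map (fun p : ℝ × ℝ => p.2 - p.1) = gaussianReal 0 θ := by
    rw [hμ, Measure.map_map (by fun_prop) hm]
    have : (fun p : ℝ × ℝ => p.2 - p.1) ∘ (fun p : ℝ × ℝ => (p.1, p.1 + p.2)) = Prod.snd := by
      ext p
      simp
    rw [this]
    exact Measure.snd_prod
  have hint_diff : Integrable (fun p : ℝ × ℝ => (p.2 - p.1) ^ 2) μ := by
    have h := integrable_sq_gaussianReal θ
    rw [← hdiff] at h
    exact h.comp_measurable (by fun_prop)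
  have hint_snd : Integrable (fun p : ℝ × ℝ => p.2 ^ 2) μ := by
    have h := integrable_sq_gaussianReal (σ2 + θ)
    rw [← hsnd] at h
    exact h.comp_measurable measurable_snd
  have hE_diff : ∫ p : ℝ × ℝ, (p.2 - p.1) ^ 2 ∂μ = θ := by
    rw [← integral_sq_gaussianReal θ, ← hdiff, integral_map (by fun_prop) (by fun_prop)]
  have hE_snd : ∫ p : ℝ × ℝ, p.2 ^ 2 ∂μ = (σ2 + θ : NNReal) := by
    rw [← integral_sq_gaussianReal (σ2 + θ), ← hsnd, integral_map (by fun_prop) (by fun_prop)]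
  have hcongr : klDiv μ ((gaussianReal 0 σ2).prod (gaussianReal 0 (σ2 + θ)))
      = ∫ p : ℝ × ℝ, (1 / 2 * log (1 + (σ2 : ℝ) / θ) - (p.2 - p.1) ^ 2 / (2 * θ)
        + p.2 ^ 2 / (2 * (σ2 + θ : NNReal))) ∂μ := by
    refine integral_congr_ae ?_
    filter_upwards [hrn] with p hp
    rw [hp, hlog]
  have hint_sub : Integrable (fun p : ℝ × ℝ =>
      1 / 2 * log (1 + (σ2 : ℝ) / θ) - (p.2 - p.1) ^ 2 / (2 * θ)) μ :=
    (integrable_const _).sub (hint_diff.div_const _)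
  rw [hcongr, integral_add hint_sub (hint_snd.div_const _), integral_sub (integrable_const _) (hint_diff.div_const _),
    integral_div, integral_div, hE_diff, hE_snd, integral_const, probReal_univ, one_smul]
  field_simp
  ring
end

section
/- (Spectral form of the information optimality of noise prediction.) Let S_N be a measurable noise power spectrum on I with S_N(f) > 0 a.e. and log S_N integrable, and let θ > 0. With the water-filling input spectrum S_X(f) := max(θ − S_N(f), 0), one has ∫ (1/2) log( 1 + S_X(f)/S_N(f) ) df = (1/2) log( θ / P_e(min(S_N, θ)) ); that is, the mutual information rate of the channel equals the scalar quantity (1/2) log(σ_U²/σ_E²) with symbol variance σ_U² = θ and slicer error variance σ_E² = P_e(min(S_N, θ)). -/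
open MeasureTheory Real Filter

theorem one_add_max_sub_div_eq_div_min {s : ℝ} (hs : 0 < s) {θ : ℝ} (hθ : 0 < θ) :
    1 + max (θ - s) 0 / s = θ / min s θ := by
  rcases le_total s θ with h | h
  · rw [max_eq_left (sub_nonneg.2 h), min_eq_left h]
    field_simp
    ring
  · rw [max_eq_right (sub_nonpos.2 h), min_eq_right h, zero_div, add_zero, div_self hθ.ne']

theorem log_min_of_pos {a b : ℝ} (ha : 0 < a) (hb : 0 < b) :
    Real.log (min a b) = min (Real.log a) (Real.log b) :=
  Real.strictMonoOn_log.monotoneOn.map_min ha hb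

theorem integrable_log_min_const {α : Type*} [MeasurableSpace α] {μ : Measure α}
    [IsFiniteMeasure μ] {S : α → ℝ} (hpos : ∀ᵐ x ∂μ, 0 < S x)
    (hlog : Integrable (fun x => Real.log (S x)) μ) {θ : ℝ} (hθ : 0 < θ) :
    Integrable (fun x => Real.log (min (S x) θ)) μ :=
  (hlog.inf (integrable_const (Real.log θ))).congr <| by
    filter_upwards [hpos] with x hx using (log_min_of_pos hx hθ).symm

/-- Spectral form of the information optimality of noise prediction: with
the water-filling input spectrum `S_X = max(θ − S_N, 0)`, the mutual
information rate `∫ (1/2) log(1 + S_X/S_N)` equals the scalar quantity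
`(1/2) log(σ_U²/σ_E²)` with symbol variance `σ_U² = θ` and slicer error
variance `σ_E² = P_e(min(S_N, θ))`. -/
theorem noise_prediction_optimality_spectral
    (SN : ℝ → ℝ) (hmeas : Measurable SN)
    (hpos : ∀ᵐ f ∂freqMeasure, 0 < SN f)
    (hlog : Integrable (fun f => Real.log (SN f)) freqMeasure)
    (θ : ℝ) (hθ : 0 < θ) :
    ∫ f, (1/2) * Real.log (1 + max (θ - SN f) 0 / SN f) ∂freqMeasure
      = (1/2) * Real.log
          (θ / Real.exp (∫ f, Real.log (min (SN f) θ) ∂freqMeasure)) := by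
  have hint := integrable_log_min_const hpos hlog hθ
  have hcongr : ∀ᵐ f ∂freqMeasure,
      (1/2) * Real.log (1 + max (θ - SN f) 0 / SN f)
        = (1/2) * (Real.log θ - Real.log (min (SN f) θ)) := by
    filter_upwards [hpos] with f hf
    rw [one_add_max_sub_div_eq_div_min hf hθ, Real.log_div hθ.ne' (lt_min hf hθ).ne']
  rw [integral_congr_ae hcongr, integral_const_mul, integral_sub (integrable_const _) hint,
    Real.log_div hθ.ne' (Real.exp_ne_zero _), Real.log_exp]
  simp
end

section
/- (Shannon upper bound on the mutual information rate of a Gaussian channel.) Let S_X and S_N be measurable power spectra on I with S_N(f) > 0 a.e.; assume S_X and S_N are integrable, log S_N and log(S_X + S_N) are integrable, and ∫ S_X(f) df ≤ P. Set σ_N² := ∫ S_N(f) df. Then ∫ (1/2) log( 1 + S_X(f)/S_N(f) ) df ≤ (1/2) log( (P + σ_N²) / P_e(S_N) ), with equality if and only if S_X(f) + S_N(f) = P + σ_N² for a.e. f (i.e., the channel output spectrum is white and the power constraint is met with equality). -/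
open MeasureTheory Real Filter

instance isProbabilityMeasure_freqMeasure : IsProbabilityMeasure freqMeasure := by
  constructor
  norm_num [freqMeasure]

/-- Jensen's inequality for the logarithm of a positive random variable whose mean is at most `C`,
together with its equality case. -/
theorem integral_log_le_log_and_eq_iff {Ω : Type*} [MeasurableSpace Ω] {μ : Measure Ω}
    [IsProbabilityMeasure μ] {Y : Ω → ℝ} {C : ℝ} (hpos : ∀ᵐ x ∂μ, 0 < Y x)
    (hint : Integrable Y μ) (hlog : Integrable (fun x => Real.log (Y x)) μ) (hC : 0 < C)
    (hYC : ∫ x, Y x ∂μ ≤ C) :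
    ∫ x, Real.log (Y x) ∂μ ≤ Real.log C ∧
      (∫ x, Real.log (Y x) ∂μ = Real.log C ↔ ∀ᵐ x ∂μ, Y x = C) := by
  have hgap_nonneg : 0 ≤ᵐ[μ] fun x => (Y x / C - 1 + Real.log C) - Real.log (Y x) := by
    filter_upwards [hpos] with x hx
    have h := Real.log_le_sub_one_of_pos (div_pos hx hC)
    rw [Real.log_div hx.ne' hC.ne'] at h
    simp only [Pi.zero_apply]
    linarith
  have hdev : Integrable (fun x => Y x / C - 1) μ := (hint.div_const C).sub (integrable_const 1)
  have hmaj : Integrable (fun x => Y x / C - 1 + Real.log C) μ := hdev.add (integrable_const _)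
  have hgap_int : Integrable (fun x => (Y x / C - 1 + Real.log C) - Real.log (Y x)) μ :=
    hmaj.sub hlog
  have hgap_eq : ∫ x, ((Y x / C - 1 + Real.log C) - Real.log (Y x)) ∂μ
      = ((∫ x, Y x ∂μ) / C - 1 + Real.log C) - ∫ x, Real.log (Y x) ∂μ := by
    rw [integral_sub hmaj hlog, integral_add hdev (integrable_const _),
      integral_sub (hint.div_const C) (integrable_const 1), integral_div]
    simp
  have hgap_integral_nonneg := integral_nonneg_of_ae hgap_nonneg
  have hmean : (∫ x, Y x ∂μ) / C ≤ 1 := (div_le_one hC).2 hYC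
  refine ⟨by linarith, fun heq => ?_, fun heq => ?_⟩
  · have hzero : ∫ x, ((Y x / C - 1 + Real.log C) - Real.log (Y x)) ∂μ = 0 := by linarith
    filter_upwards [(integral_eq_zero_iff_of_nonneg_ae hgap_nonneg hgap_int).1 hzero, hpos]
      with x hx hxpos
    by_contra hne
    have h := Real.log_lt_sub_one_of_pos (div_pos hxpos hC)
      (fun h => hne ((div_eq_one_iff_eq hC.ne').1 h))
    rw [Real.log_div hxpos.ne' hC.ne'] at h
    simp only [Pi.zero_apply] at hx
    linarith
  · have hconst : ∫ x, Real.log (Y x) ∂μ = ∫ _, Real.log C ∂μ := by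
      refine integral_congr_ae ?_
      filter_upwards [heq] with x hx
      rw [hx]
    simpa using hconst

/-- Shannon upper bound on the mutual information rate of a Gaussian channel:
`∫ (1/2) log(1 + S_X/S_N) ≤ (1/2) log((P + σ_N²)/P_e(S_N))`, with equality
iff the output spectrum `S_X + S_N` is a.e. equal to the constant
`P + σ_N²` (white output and power constraint met with equality). -/
theorem shannon_upper_bound
    (SX SN : ℝ → ℝ) (hXmeas : Measurable SX) (hNmeas : Measurable SN)
    (hXnonneg : ∀ᵐ f ∂freqMeasure, 0 ≤ SX f)
    (hNpos : ∀ᵐ f ∂freqMeasure, 0 < SN f)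
    (hXint : Integrable SX freqMeasure)
    (hNint : Integrable SN freqMeasure)
    (hlogN : Integrable (fun f => Real.log (SN f)) freqMeasure)
    (hlogXN : Integrable (fun f => Real.log (SX f + SN f)) freqMeasure)
    (P : ℝ) (hP : ∫ f, SX f ∂freqMeasure ≤ P) :
    (∫ f, (1/2) * Real.log (1 + SX f / SN f) ∂freqMeasure
      ≤ (1/2) * Real.log ((P + ∫ f, SN f ∂freqMeasure)
          / Real.exp (∫ f, Real.log (SN f) ∂freqMeasure))) ∧
    ((∫ f, (1/2) * Real.log (1 + SX f / SN f) ∂freqMeasure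
        = (1/2) * Real.log ((P + ∫ f, SN f ∂freqMeasure)
            / Real.exp (∫ f, Real.log (SN f) ∂freqMeasure)))
      ↔ ∀ᵐ f ∂freqMeasure, SX f + SN f = P + ∫ g, SN g ∂freqMeasure) := by
  have hYpos : ∀ᵐ f ∂freqMeasure, 0 < SX f + SN f := by
    filter_upwards [hXnonneg, hNpos] with f hX hN
    linarith
  have hN0 : 0 < ∫ f, SN f ∂freqMeasure := by
    have hnonneg : 0 ≤ᵐ[freqMeasure] SN := hNpos.mono fun _ h => h.le
    refine (integral_nonneg_of_ae hnonneg).lt_of_ne' fun h => ?_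
    obtain ⟨f, hf, hf'⟩ :=
      (hNpos.and ((integral_eq_zero_iff_of_nonneg_ae hnonneg hNint).1 h)).exists
    exact hf.ne' hf'
  have hC : 0 < P + ∫ f, SN f ∂freqMeasure := by
    linarith [integral_nonneg_of_ae hXnonneg]
  have hYC : ∫ f, (SX f + SN f) ∂freqMeasure ≤ P + ∫ f, SN f ∂freqMeasure := by
    rw [integral_add hXint hNint]
    linarith
  obtain ⟨hle, hiff⟩ := integral_log_le_log_and_eq_iff hYpos (hXint.add hNint) hlogXN hC hYC
  have hrate : ∫ f, (1/2) * Real.log (1 + SX f / SN f) ∂freqMeasure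
      = (1/2) * (∫ f, Real.log (SX f + SN f) ∂freqMeasure
        - ∫ f, Real.log (SN f) ∂freqMeasure) := by
    rw [integral_const_mul, ← integral_sub hlogXN hlogN]
    congr 1
    refine integral_congr_ae ?_
    filter_upwards [hYpos, hNpos] with f hY hN
    rw [← Real.log_div hY.ne' hN.ne', add_div, div_self hN.ne', add_comm]
  rw [hrate, Real.log_div hC.ne' (Real.exp_ne_zero _), Real.log_exp]
  refine ⟨by linarith, Iff.trans ⟨fun h => ?_, fun h => ?_⟩ hiff⟩
  · linarith
  · rw [h]
end
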